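/- Define u(n,k) = Π_{p ≤ k} p^{v_p(C(n,k))} and f(n) = min{0 ≤ k ≤ n : u(n,k) > n²}. For all sufficiently large n, f(n) ≤ 7 (log n)². -/

import Mathlib

noncomputable def u (n k : ℕ) : ℕ :=
  ∏ p ∈ (Finset.range (k + 1)).filter Nat.Prime,
    p ^ (n.choose k).factorization p

noncomputable def f (n : ℕ) : ℕ :=
  sInf {k : ℕ | k ≤ n ∧ n ^ 2 < u n k}

open Nat Finset Chebyshev Filter

theorem factorial_mul_factorial_dvd_lcmUpto_mul (m : ℕ) :
    (30 * m)! * m ! ∣ lcmUpto (30 * m) * ((15 * m)! * (10 * m)! * (6 * m)!) := by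
  have hl := lcmUpto_ne_zero (30 * m)
  rw [← Nat.factorization_prime_le_iff_dvd (by positivity) (by positivity)]
  intro p hp
  have hb : ∀ j ≤ 30 * m, (j !).factorization p =
      ∑ i ∈ Ico 1 (Nat.log p (30 * m) + 1), j / p ^ i := fun j hj =>
    Nat.factorization_factorial hp (Nat.lt_succ_of_le (Nat.log_mono_right hj))
  rw [Nat.factorization_mul (by positivity) (by positivity),
    Nat.factorization_mul (by positivity) (by positivity),
    Nat.factorization_mul (by positivity) (by positivity),
    Nat.factorization_mul (by positivity) (by positivity)]
  simp only [Finsupp.add_apply]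
  rw [factorization_lcmUpto _ hp, hb _ le_rfl, hb _ (by omega), hb _ (by omega), hb _ (by omega),
    hb _ (by omega)]
  have hc : Nat.log p (30 * m) = ∑ i ∈ Ico 1 (Nat.log p (30 * m) + 1), 1 := by simp
  nth_rw 3 [hc]
  simp only [← sum_add_distrib]
  refine sum_le_sum fun i _ => ?_
  have h (d : ℕ) (e : ℕ) (hd : 0 < d) (h : d * e = 30) : e * m / p ^ i = 30 * m / p ^ i / d := by
    rw [Nat.div_div_eq_div_mul, mul_comm (p ^ i), ← Nat.div_div_eq_div_mul, ← h, mul_assoc,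
      Nat.mul_div_cancel_left _ hd]
  have h1 := h 30 1 (by norm_num) (by norm_num)
  rw [one_mul] at h1
  rw [h 2 15 (by norm_num) (by norm_num), h 3 10 (by norm_num) (by norm_num),
    h 5 6 (by norm_num) (by norm_num), h1]
  omega

theorem log_factorial_le {n : ℕ} (hn : n ≠ 0) :
    Real.log n ! ≤ n * Real.log n - n + Real.log n / 2 + 1 := by
  obtain ⟨k, rfl⟩ := Nat.exists_eq_succ_of_ne_zero hn
  have h := Stirling.log_stirlingSeq'_antitone (Nat.zero_le k)
  have hk : ((k.succ : ℕ) : ℝ) ≠ 0 := by positivity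
  simp only [Function.comp_apply, Stirling.log_stirlingSeq_formula] at h
  rw [Real.log_mul two_ne_zero hk, Real.log_div hk (Real.exp_ne_zero 1), Real.log_exp] at h
  simp at h
  simp only [Nat.succ_eq_add_one, Nat.cast_add, Nat.cast_one]
  linarith

theorem eventually_le_theta : ∀ᶠ m : ℕ in atTop, (27 * m : ℝ) ≤ θ (30 * m) := by
  have h1 : Tendsto (fun m : ℕ => (30 * m : ℝ)) atTop atTop :=
    tendsto_natCast_atTop_atTop.const_mul_atTop (by norm_num)
  have h2 := h1.eventually ((isLittleO_log_rpow_atTop (r := 1 / 2) (by norm_num)).bound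
    (c := 1 / 10000) (by norm_num))
  filter_upwards [h2, eventually_ge_atTop 10000] with m hm hm0
  have hm0' : (10000 : ℝ) ≤ m := by exact_mod_cast hm0
  have hx : (1 : ℝ) ≤ 30 * m := by linarith
  have hlog : 0 ≤ Real.log (30 * m) := Real.log_nonneg hx
  rw [← Real.sqrt_eq_rpow, Real.norm_of_nonneg hlog, Real.norm_of_nonneg (Real.sqrt_nonneg _)] at hm
  set s := √(30 * m : ℝ)
  have hs : s * s = 30 * m := Real.mul_self_sqrt (by positivity)
  have hs1 : 1 ≤ s := Real.one_le_sqrt.2 hx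
  have hpsi := psi_sub_theta_le hx
  have hm1 : m ≠ 0 := by omega
  have hd := Real.log_le_log (by positivity) (Nat.cast_le (α := ℝ).2 (Nat.le_of_dvd
    (by have := lcmUpto_pos (30 * m); positivity) (factorial_mul_factorial_dvd_lcmUpto_mul m)))
  have hl : ((lcmUpto (30 * m) : ℕ) : ℝ) ≠ 0 := by exact_mod_cast lcmUpto_ne_zero _
  push_cast at hd
  rw [Real.log_mul (by positivity) (by positivity), Real.log_mul hl (by positivity),
    Real.log_mul (by positivity) (by positivity), Real.log_mul (by positivity) (by positivity),
    ← psi_eq_log_lcmUpto] at hd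
  have a1 := Stirling.le_log_factorial_stirling (n := 30 * m) (by omega)
  have a2 := Stirling.le_log_factorial_stirling (n := m) (by omega)
  have b1 := log_factorial_le (n := 15 * m) (by omega)
  have b2 := log_factorial_le (n := 10 * m) (by omega)
  have b3 := log_factorial_le (n := 6 * m) (by omega)
  have hmr : (m : ℝ) ≠ 0 := by positivity
  have hp : 0 ≤ Real.log (2 * Real.pi) := Real.log_nonneg (by linarith [Real.pi_gt_three])
  have hlm : 0 ≤ Real.log m := Real.log_nonneg (by linarith)
  push_cast at a1 a2 b1 b2 b3 hd
  have key : (39 : ℝ) * Real.log 2 ≤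
      30 * Real.log 30 - 15 * Real.log 15 - 10 * Real.log 10 - 6 * Real.log 6 := by
    have e30 : Real.log 30 = Real.log 2 + Real.log 3 + Real.log 5 := by
      rw [← Real.log_mul (by norm_num) (by norm_num), ← Real.log_mul (by norm_num) (by norm_num)]
      norm_num
    have e15 : Real.log 15 = Real.log 3 + Real.log 5 := by
      rw [← Real.log_mul (by norm_num) (by norm_num)]; norm_num
    have e10 : Real.log 10 = Real.log 2 + Real.log 5 := by
      rw [← Real.log_mul (by norm_num) (by norm_num)]; norm_num
    have e6 : Real.log 6 = Real.log 2 + Real.log 3 := by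
      rw [← Real.log_mul (by norm_num) (by norm_num)]; norm_num
    have : 25 * Real.log 2 ≤ 9 * Real.log 3 + 5 * Real.log 5 := by
      have := Real.log_le_log (x := 2 ^ 25) (y := 3 ^ 9 * 5 ^ 5) (by norm_num) (by norm_num)
      rw [Real.log_mul (by norm_num) (by norm_num), Real.log_pow, Real.log_pow, Real.log_pow] at this
      norm_num at this
      exact this
    linarith
  have hl15 : Real.log (15 * m) ≤ Real.log (30 * m) := Real.log_le_log (by positivity) (by linarith)
  have hl10 : Real.log (10 * m) ≤ Real.log (30 * m) := Real.log_le_log (by positivity) (by linarith)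
  have hl6 : Real.log (6 * m) ≤ Real.log (30 * m) := Real.log_le_log (by positivity) (by linarith)
  have key2 := mul_le_mul_of_nonneg_left key (show (0 : ℝ) ≤ m by positivity)
  have hid : 30 * m * Real.log (30 * m) + m * Real.log m - 15 * m * Real.log (15 * m)
      - 10 * m * Real.log (10 * m) - 6 * m * Real.log (6 * m) =
      m * (30 * Real.log 30 - 15 * Real.log 15 - 10 * Real.log 10 - 6 * Real.log 6) := by
    rw [Real.log_mul (by norm_num) hmr, Real.log_mul (by norm_num) hmr,
      Real.log_mul (by norm_num) hmr, Real.log_mul (by norm_num) hmr]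
    ring
  have hlog2 := mul_le_mul_of_nonneg_left Real.log_two_gt_d9.le (show (0 : ℝ) ≤ m by positivity)
  have hsl : s * Real.log (30 * m) ≤ 1 / 10000 * (30 * m) := by
    calc s * Real.log (30 * m) ≤ s * (1 / 10000 * s) := by gcongr
      _ = 1 / 10000 * (30 * m) := by rw [← hs]; ring
  have hsl' : Real.log (30 * m) ≤ s * Real.log (30 * m) := le_mul_of_one_le_left hlog hs1
  linarith

theorem factorization_choose_pos_of_mod_lt {n k p : ℕ} (hp : p.Prime) (hk : k ≤ n)
    (h : n % p < k % p) : 1 ≤ (n.choose k).factorization p := by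
  have := Fact.mk hp
  have hl := Choose.choose_modEq_choose_mod_mul_choose_div_nat (n := n) (k := k) (p := p)
  rw [Nat.choose_eq_zero_of_lt h, zero_mul] at hl
  exact (hp.dvd_iff_one_le_factorization (Nat.choose_pos hk).ne').1
    ((Nat.modEq_zero_iff_dvd).1 hl)

theorem sum_log_le_log_u {n k x : ℕ} (hx : x ≤ k) (hk : k ≤ n) :
    ∑ p ∈ primesLE x with n % p < k % p, Real.log p ≤ Real.log (u n k) := by
  have hP : ∀ p ∈ (Finset.range (k + 1)).filter Nat.Prime, (1 : ℝ) ≤ p := fun p hp => by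
    exact_mod_cast (mem_filter.1 hp).2.one_le
  rw [u, Nat.cast_prod, Real.log_prod fun p hp => by
    have := hP p hp
    push_cast
    positivity]
  calc ∑ p ∈ primesLE x with n % p < k % p, Real.log p
      ≤ ∑ p ∈ primesLE x with n % p < k % p,
          Real.log ((p ^ (n.choose k).factorization p : ℕ) : ℝ) := by
        refine sum_le_sum fun p hp => ?_
        rw [mem_filter, Nat.mem_primesLE] at hp
        have h1 := factorization_choose_pos_of_mod_lt hp.1.2 hk hp.2
        push_cast
        rw [Real.log_pow]
        exact le_mul_of_one_le_left (Real.log_natCast_nonneg p) (by exact_mod_cast h1)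
    _ ≤ _ := by
        refine sum_le_sum_of_subset_of_nonneg (fun p hp => ?_) fun p _ _ =>
          Real.log_natCast_nonneg _
        rw [mem_filter, Nat.mem_primesLE] at hp
        rw [mem_filter, Finset.mem_range]
        exact ⟨by omega, hp.1.2⟩

theorem sum_log_dvd_le {n : ℕ} (hn : n ≠ 0) (x : ℕ) :
    ∑ p ∈ primesLE x with p ∣ n, Real.log p ≤ Real.log n := by
  have h : ∏ p ∈ primesLE x with p ∣ n, p ∣ n := by
    refine Finset.prod_primes_dvd _ (fun p hp => ?_) fun p hp => (mem_filter.1 hp).2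
    rw [mem_filter, Nat.mem_primesLE] at hp
    exact hp.1.2.prime
  have hpos := Nat.pos_of_dvd_of_pos h (Nat.pos_of_ne_zero hn)
  rw [← Real.log_prod, ← Nat.cast_prod]
  · exact Real.log_le_log (by exact_mod_cast hpos)
      (by exact_mod_cast Nat.le_of_dvd (Nat.pos_of_ne_zero hn) h)
  · intro p hp
    rw [mem_filter, Nat.mem_primesLE] at hp
    exact_mod_cast hp.1.2.ne_zero

theorem theta_sub_le_sum_log {n s h : ℕ} (hn : n ≠ 0) (hs : s ≤ h) (x : ℕ) :
    θ x - s * Real.log (n + h) ≤ ∑ p ∈ primesLE x with s < p - n % p, Real.log p := by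
  rw [theta_eq_sum_primesLE_log,
    ← sum_filter_add_sum_filter_not (primesLE x) (fun p => s < p - n % p)]
  suffices H : ∑ p ∈ primesLE x with ¬ s < p - n % p, Real.log p ≤ s * Real.log (n + h) by
    linarith
  calc ∑ p ∈ primesLE x with ¬ s < p - n % p, Real.log p
      ≤ ∑ p ∈ primesLE x, ∑ i ∈ Icc 1 s, if p ∣ n + i then Real.log p else 0 := by
        rw [sum_filter]
        refine sum_le_sum fun p hp => ?_
        rw [Nat.mem_primesLE] at hp
        have hnn : ∀ i ∈ Icc 1 s, (0 : ℝ) ≤ if p ∣ n + i then Real.log p else 0 := fun i _ => by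
          split_ifs
          · exact Real.log_natCast_nonneg p
          · rfl
        split_ifs with hc
        · exact sum_nonneg hnn
        · have hlt := Nat.mod_lt n hp.2.pos
          have hd : p ∣ n + (p - n % p) := by
            refine ⟨n / p + 1, ?_⟩
            have := Nat.div_add_mod n p
            rw [mul_add]
            omega
          have := single_le_sum hnn (mem_Icc.2 ⟨by omega, by omega⟩ : p - n % p ∈ Icc 1 s)
          rwa [if_pos hd] at this
    _ = ∑ i ∈ Icc 1 s, ∑ p ∈ primesLE x with p ∣ n + i, Real.log p := by
        rw [sum_comm]
        simp only [sum_filter]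
    _ ≤ ∑ i ∈ Icc 1 s, Real.log (n + h) := by
        refine sum_le_sum fun i hi => (sum_log_dvd_le (by omega) x).trans ?_
        rw [mem_Icc] at hi
        exact Real.log_le_log (by exact_mod_cast (by omega : 0 < n + i))
          (by exact_mod_cast (by omega : n + i ≤ n + h))
    _ = s * Real.log (n + h) := by simp

theorem exists_multiple_mem_Ioc {m p : ℕ} (hp : 0 < p) (hpm : p ≤ 30 * m) :
    ∃ c, 40 * m < p * c ∧ p * c ≤ 60 * m := by
  rcases le_or_gt p (20 * m) with h | h
  · refine ⟨60 * m / p, ?_, Nat.mul_div_le _ _⟩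
    have := Nat.lt_mul_div_succ (60 * m) hp
    rw [mul_add] at this
    omega
  · exact ⟨2, by omega, by omega⟩

theorem mod_lt_mod_mul_sub {n p c s : ℕ} (hs : 0 < s) (h : s < p - n % p) (hc : 0 < c) :
    n % p < (p * c - s) % p := by
  obtain ⟨c, rfl⟩ := Nat.exists_eq_succ_of_ne_zero hc.ne'
  have : p * c.succ - s = (p - s) + p * c := by
    rw [Nat.mul_succ]
    omega
  rw [this, Nat.add_mul_mod_self_left, Nat.mod_eq_of_lt (by omega : p - s < p)]
  omega

theorem sum_theta_sub_le_sum_log_u {n m h : ℕ} (hn : n ≠ 0) (hh : h ≤ 10 * m) (hm : 60 * m ≤ n) :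
    ∑ s ∈ Icc 1 h, (θ (30 * m) - s * Real.log (n + h)) ≤
      ∑ k ∈ Icc (40 * m - h) (60 * m), Real.log (u n k) := by
  calc ∑ s ∈ Icc 1 h, (θ (30 * m) - s * Real.log (n + h))
      ≤ ∑ s ∈ Icc 1 h, ∑ p ∈ primesLE (30 * m) with s < p - n % p, Real.log p := by
        refine sum_le_sum fun s hs => ?_
        have := theta_sub_le_sum_log hn (mem_Icc.1 hs).2 (30 * m)
        push_cast at this
        exact this
    _ = ∑ p ∈ primesLE (30 * m), ∑ s ∈ Icc 1 h with s < p - n % p, Real.log p := by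
        simp only [sum_filter]
        exact sum_comm
    _ ≤ ∑ p ∈ primesLE (30 * m),
          ∑ k ∈ Icc (40 * m - h) (60 * m) with n % p < k % p, Real.log p := by
        refine sum_le_sum fun p hp => ?_
        rw [Nat.mem_primesLE] at hp
        obtain ⟨c, hc1, hc2⟩ := exists_multiple_mem_Ioc hp.2.pos hp.1
        simp only [sum_const, nsmul_eq_mul]
        refine mul_le_mul_of_nonneg_right ?_ (Real.log_natCast_nonneg p)
        refine Nat.cast_le.2 (card_le_card_of_injOn (fun s => p * c - s) (fun s hs => ?_) ?_)
        · simp only [coe_filter, mem_Icc, Set.mem_ofPred_eq] at hs ⊢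
          exact ⟨⟨by omega, by omega⟩, mod_lt_mod_mul_sub hs.1.1 hs.2
            (Nat.pos_of_ne_zero fun h0 => by simp [h0] at hc1)⟩
        · intro s hs t ht hst
          simp only [coe_filter, mem_Icc, Set.mem_ofPred_eq] at hs ht hst
          omega
    _ = ∑ k ∈ Icc (40 * m - h) (60 * m),
          ∑ p ∈ primesLE (30 * m) with n % p < k % p, Real.log p := by
        simp only [sum_filter]
        exact sum_comm
    _ ≤ _ := by
        refine sum_le_sum fun k hk => ?_
        rw [mem_Icc] at hk
        exact sum_log_le_log_u (by omega) (by omega)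

theorem exists_sq_lt_u {n m h : ℕ} {L : ℝ} (hn : n ≠ 0) (hL : L = Real.log n) (hL0 : 1000 ≤ L)
    (hm : 60 * m ≤ n) (hm1 : 60 * (m : ℝ) ≤ 7 * L ^ 2) (hm2 : 7 * L ^ 2 - 60 ≤ 60 * (m : ℝ))
    (hh1 : (h : ℝ) ≤ 3 * L) (hh2 : 3 * L - 1 ≤ h) (hθ : (27 * m : ℝ) ≤ θ (30 * m)) :
    ∃ k ≤ 60 * m, n ^ 2 < u n k := by
  by_contra! hu
  have hhm : h ≤ 10 * m := by
    have : (h : ℝ) ≤ 10 * m := by nlinarith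
    exact_mod_cast this
  have hnh : Real.log (n + h) ≤ L + 1 := by
    have hn' : (0 : ℝ) < n := by positivity
    have hhn : (h : ℝ) ≤ n := by exact_mod_cast (by omega : h ≤ n)
    calc Real.log (n + h) ≤ Real.log (2 * n) :=
          Real.log_le_log (by positivity) (by linarith)
      _ = Real.log 2 + L := by rw [Real.log_mul two_ne_zero hn'.ne', hL]
      _ ≤ L + 1 := by linarith [Real.log_two_lt_d9]
  have hlow : (h : ℝ) * (27 * m) - h * (h + 1) / 2 * (L + 1) ≤
      ∑ s ∈ Icc 1 h, (θ (30 * m) - s * Real.log (n + h)) := by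
    calc (h : ℝ) * (27 * m) - h * (h + 1) / 2 * (L + 1)
        = ∑ s ∈ Icc 1 h, ((27 * m : ℝ) - s * (L + 1)) := by
          have hsum : ∀ j : ℕ, ∑ s ∈ Icc 1 j, (s : ℝ) = j * (j + 1) / 2 := fun j => by
            induction j with
            | zero => simp
            | succ j ih =>
              rw [sum_Icc_succ_top (by omega), ih]
              push_cast
              ring
          rw [sum_sub_distrib, ← sum_mul _ _ (L + 1), hsum]
          simp
      _ ≤ _ := sum_le_sum fun s _ => by gcongr
  have hup : ∑ k ∈ Icc (40 * m - h) (60 * m), Real.log (u n k) ≤ (20 * m + h + 1) * (2 * L) := by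
    calc ∑ k ∈ Icc (40 * m - h) (60 * m), Real.log (u n k)
        ≤ ∑ k ∈ Icc (40 * m - h) (60 * m), 2 * L := by
          refine sum_le_sum fun k hk => ?_
          have hk := hu k (mem_Icc.1 hk).2
          rcases Nat.eq_zero_or_pos (u n k) with h0 | h0
          · rw [h0, Nat.cast_zero, Real.log_zero]
            linarith
          · calc Real.log (u n k) ≤ Real.log ((n : ℝ) ^ 2) :=
                  Real.log_le_log (by exact_mod_cast h0) (by exact_mod_cast hk)
              _ = 2 * L := by rw [Real.log_pow, hL]; norm_num
      _ = (20 * m + h + 1) * (2 * L) := by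
          rw [sum_const, Nat.card_Icc, nsmul_eq_mul,
            show 60 * m + 1 - (40 * m - h) = 20 * m + h + 1 by omega]
          push_cast
          ring
  have hmain := hlow.trans ((sum_theta_sub_le_sum_log_u hn hhm hm).trans hup)
  have e1 : (3 * L - 1) * (27 * (7 * L ^ 2 - 60)) ≤ h * (27 * (60 * m)) := by
    gcongr
    nlinarith
  have e2 : (h : ℝ) * (h + 1) / 2 * (L + 1) ≤ 3 * L * (3 * L + 1) / 2 * (L + 1) := by
    gcongr
  have e3 : (20 * m + h + 1) * (2 * L) ≤ (7 * L ^ 2 / 3 + 3 * L + 1) * (2 * L) := by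
    gcongr
    linarith
  nlinarith [mul_le_mul_of_nonneg_right hL0 (sq_nonneg L)]

theorem stmt_8 :
    ∃ N : ℕ, ∀ n ≥ N, (f n : ℝ) ≤ 7 * Real.log n ^ 2 := by
  rw [← eventually_atTop]
  have hlog : Tendsto (fun n : ℕ => Real.log n) atTop atTop :=
    Real.tendsto_log_atTop.comp tendsto_natCast_atTop_atTop
  have hM : Tendsto (fun n : ℕ => ⌊7 / 60 * Real.log n ^ 2⌋₊) atTop atTop :=
    tendsto_nat_floor_atTop.comp
      (((tendsto_pow_atTop two_ne_zero).comp hlog).const_mul_atTop (by norm_num))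
  have hsq := tendsto_natCast_atTop_atTop.eventually
    ((Real.isLittleO_pow_log_id_atTop (n := 2)).bound (c := 1 / 7) (by norm_num))
  filter_upwards [hlog.eventually_ge_atTop 1000, hM.eventually eventually_le_theta, hsq,
    eventually_ge_atTop 1] with n hL hθ hn hn1
  set L := Real.log n with hLdef
  set m := ⌊7 / 60 * L ^ 2⌋₊
  have hm1 : (m : ℝ) ≤ 7 / 60 * L ^ 2 := Nat.floor_le (by positivity)
  have hm2 : 7 / 60 * L ^ 2 < m + 1 := Nat.lt_floor_add_one _
  have hh1 : ((⌊3 * L⌋₊ : ℕ) : ℝ) ≤ 3 * L := Nat.floor_le (by linarith)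
  have hh2 : 3 * L < ⌊3 * L⌋₊ + 1 := Nat.lt_floor_add_one _
  have hmn : 60 * m ≤ n := by
    rw [Real.norm_of_nonneg (by positivity), id, Real.norm_of_nonneg (by positivity)] at hn
    have : 60 * (m : ℝ) ≤ n := by linarith
    exact_mod_cast this
  obtain ⟨k, hk, hu⟩ := exists_sq_lt_u (by omega) hLdef hL hmn (by linarith) (by linarith)
    hh1 (by linarith) hθ
  have hf : f n ≤ k := Nat.sInf_le ⟨hk.trans hmn, hu⟩
  have : (f n : ℝ) ≤ 60 * m := by exact_mod_cast hf.trans hk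
  linarith
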